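/- arXiv:2506.00840 — 2 statements merged into one kernel-verified Lean document; each statement's English description precedes it below -/
import Mathlib

section
/- In the location-scale-shift model with bounded shift terms, let p_{N,T} ∈ (0,1) be an extreme tail quantile level with NT·p_{N,T}/k → 0 and (log(k/(NT·p_{N,T})))/√k → 0, and suppose √k·A₁(NT/k) → 0, as N,T → ∞ jointly. Then the extreme tail quantile is asymptotically equivalent to the Weissman extrapolation: lim_{N,T→∞} max_{1≤i≤N, 1≤t≤T} | (α_{i,t} + w_{i,t}·U(NT/k)·(k/(NT·p_{N,T}))^γ) / U(1/p_{N,T}) − w_{i,t} | = 0. -/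
open MeasureTheory ProbabilityTheory Filter Topology

noncomputable section

/-- A function whose multiplicative increments vanish pointwise, and whose dyadic increments are
dominated by a geometrically decaying control, converges at infinity. No measurability is needed. -/
theorem exists_tendsto_atTop_of_dyadic_control (g d : ℝ → ℝ) (θ : ℝ) (hθ0 : 0 ≤ θ) (hθ : θ < 1)
    (hg : ∀ x : ℝ, 0 < x → Tendsto (fun s => g (s * x) - g s) atTop (𝓝 0))
    (hgd : ∀ᶠ s in atTop, |g (s * 2) - g s| ≤ d s)
    (hdd : ∀ᶠ s in atTop, d (s * 2) ≤ θ * d s)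
    (hd : Tendsto d atTop (𝓝 0)) : ∃ l, Tendsto g atTop (𝓝 l) := by
  apply cauchySeq_tendsto_of_complete
  rw [Metric.cauchySeq_iff]
  intro ε hε
  have hη : 0 < ε / 4 * (1 - θ) := mul_pos (by linarith) (by linarith)
  have hdη : ∀ᶠ s in atTop, d s < ε / 4 * (1 - θ) := hd.eventually_lt_const hη
  obtain ⟨S, hS⟩ := eventually_atTop.1 ((hgd.and hdd).and (hdη.and (eventually_ge_atTop 1)))
  have hS' : ∀ s, S ≤ s → ∀ n : ℕ, S ≤ s * 2 ^ n := by
    intro s hs n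
    have h1 : (1 : ℝ) ≤ s := (hS s hs).2.2
    have h2 : (1 : ℝ) ≤ 2 ^ n := one_le_pow₀ (by norm_num)
    nlinarith
  have hdn : ∀ s, S ≤ s → ∀ n : ℕ, d (s * 2 ^ n) ≤ θ ^ n * d s := by
    intro s hs n
    induction n with
    | zero => simp
    | succ n ih =>
      calc d (s * 2 ^ (n + 1)) = d (s * 2 ^ n * 2) := by rw [pow_succ, mul_assoc]
        _ ≤ θ * d (s * 2 ^ n) := (hS _ (hS' s hs n)).1.2
        _ ≤ θ * (θ ^ n * d s) := mul_le_mul_of_nonneg_left ih hθ0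
        _ = θ ^ (n + 1) * d s := by ring
  have hgn : ∀ s, S ≤ s → ∀ n : ℕ, |g (s * 2 ^ n) - g s| * (1 - θ) ≤ (1 - θ ^ n) * d s := by
    intro s hs n
    induction n with
    | zero => simp
    | succ n ih =>
      have h1 : |g (s * 2 ^ (n + 1)) - g (s * 2 ^ n)| ≤ θ ^ n * d s := by
        have := (hS _ (hS' s hs n)).1.1
        rw [mul_assoc, ← pow_succ] at this
        exact this.trans (hdn s hs n)
      have h2 := abs_sub_le (g (s * 2 ^ (n + 1))) (g (s * 2 ^ n)) (g s)
      have h3 := mul_le_mul_of_nonneg_right (h2.trans (add_le_add_left h1 _))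
        (by linarith : (0 : ℝ) ≤ 1 - θ)
      rw [pow_succ θ n]
      linarith
  have hgε : ∀ s, S ≤ s → ∀ n : ℕ, |g (s * 2 ^ n) - g s| ≤ ε / 4 := by
    intro s hs n
    have h0 : 0 ≤ d s := (abs_nonneg _).trans (hS s hs).1.1
    have h1 : 0 ≤ θ ^ n * d s := mul_nonneg (pow_nonneg hθ0 n) h0
    refine le_of_mul_le_mul_right ?_ (by linarith : (0 : ℝ) < 1 - θ)
    have := hgn s hs n
    have := (hS s hs).2.1
    linarith
  refine ⟨S, fun s hs t ht => ?_⟩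
  have hs0 : 0 < s := by linarith [(hS s hs).2.2]
  have ht0 : 0 < t := by linarith [(hS t ht).2.2]
  have hlim : Tendsto (fun n : ℕ => t * 2 ^ n) atTop atTop :=
    (tendsto_pow_atTop_atTop_of_one_lt (by norm_num : (1 : ℝ) < 2)).const_mul_atTop ht0
  have hst := ((hg (s / t) (by positivity)).comp hlim).abs
  rw [abs_zero] at hst
  obtain ⟨n, hn⟩ := (hst.eventually_lt_const (by linarith : 0 < ε / 4)).exists
  have he : t * 2 ^ n * (s / t) = s * 2 ^ n := by field_simp
  simp only [Function.comp, he] at hn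
  have h1 := abs_le.1 (hgε s hs n)
  have h2 := abs_le.1 (hgε t ht n)
  have h3 := abs_lt.1 hn
  rw [Real.dist_eq, abs_lt]
  constructor <;> linarith [h1.1, h1.2, h2.1, h2.2, h3.1, h3.2]

/-- Under the second-order condition with negative second-order parameter, `U s` is asymptotic to a
positive multiple of `s ^ γ`. -/
theorem exists_tendsto_div_rpow_of_second_order {γ ρ : ℝ} (hρ : ρ < 0) {U A : ℝ → ℝ}
    (hU : ∀ s : ℝ, 0 < s → 0 < U s) (hApos : ∀ s : ℝ, 0 < s → 0 < A s)
    (hA : Tendsto A atTop (𝓝 0))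
    (hU2 : ∀ x : ℝ, 0 < x →
      Tendsto (fun s : ℝ => (U (s * x) / U s - x ^ γ) / A s) atTop
        (𝓝 (x ^ γ * (x ^ ρ - 1) / ρ))) :
    ∃ l : ℝ, 0 < l ∧ Tendsto (fun s => U s / s ^ γ) atTop (𝓝 l) := by
  have hpos := eventually_gt_atTop (0 : ℝ)
  have hU1 : ∀ x : ℝ, 0 < x → Tendsto (fun s => U (s * x) / U s) atTop (𝓝 (x ^ γ)) := by
    intro x hx
    have h := ((hU2 x hx).mul hA).add_const (x ^ γ)
    rw [mul_zero, zero_add] at h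
    refine h.congr' ?_
    filter_upwards [hpos] with s hs
    have := (hApos s hs).ne'
    field_simp
    ring
  set a : ℝ := 2 ^ γ with ha
  have ha0 : 0 < a := by positivity
  set b : ℝ := 2 ^ ρ with hb
  have hb0 : 0 < b := by positivity
  have hb1 : b < 1 := Real.rpow_lt_one_of_one_lt_of_neg (by norm_num) hρ
  have h2 := hU2 2 (by norm_num)
  rw [← ha, ← hb] at h2
  have hc : 0 < a * (b - 1) / ρ := div_pos_of_neg_of_neg (by nlinarith) hρ
  have h4 := hU2 4 (by norm_num)
  have e4 : ∀ y : ℝ, (4 : ℝ) ^ y = 2 ^ y * 2 ^ y := fun y => by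
    rw [← Real.mul_rpow (by norm_num) (by norm_num)]; norm_num
  rw [e4, e4, ← ha, ← hb] at h4
  have hQ := hU1 2 (by norm_num)
  rw [← ha] at hQ
  have hratio : Tendsto (fun s => (U (s * 2 * 2) / U (s * 2) - a) / (U (s * 2) / U s - a))
      atTop (𝓝 b) := by
    have h := ((h4.sub (h2.const_mul a)).div hQ ha0.ne').div h2 hc.ne'
    have e : (a * a * (b * b - 1) / ρ - a * (a * (b - 1) / ρ)) / a / (a * (b - 1) / ρ) = b := by
      have h1 : b - 1 ≠ 0 := by linarith
      have h2 := hρ.ne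
      field_simp
      ring
    rw [e] at h
    refine h.congr' ?_
    filter_upwards [hpos, h2.eventually_const_lt hc] with s hs hs2
    have hA0 := hApos s hs
    have hu := (hU s hs).ne'
    have hu2 := (hU (s * 2) (by linarith)).ne'
    have hd : U (s * 2) / U s - a ≠ 0 := fun h => by simp [h] at hs2
    have e : s * 4 = s * 2 * 2 := by ring
    have e2 : U (s * 2 * 2) / U s = U (s * 2 * 2) / U (s * 2) * (U (s * 2) / U s) := by
      field_simp
    have hq : U (s * 2) / U s ≠ 0 := div_ne_zero hu2 hu
    simp only [Pi.div_apply, e, e2]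
    generalize U (s * 2 * 2) / U (s * 2) = Q' at *
    generalize U (s * 2) / U s = Q at *
    have := hA0.ne'
    field_simp
    ring
  have hglog : ∀ x s : ℝ, 0 < x → 0 < s →
      Real.log (U (s * x) / (s * x) ^ γ) - Real.log (U s / s ^ γ)
        = Real.log (U (s * x) / U s / x ^ γ) := by
    intro x s hx hs
    have h1 := hU s hs
    have h2 := hU (s * x) (by positivity)
    have h3 : 0 < x ^ γ := by positivity
    have h4 : 0 < s ^ γ := by positivity
    rw [← Real.log_div (by positivity) (by positivity), Real.mul_rpow hs.le hx.le]
    congr 1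
    field_simp
  suffices h : ∃ l, Tendsto (fun s => Real.log (U s / s ^ γ)) atTop (𝓝 l) by
    obtain ⟨l, hl⟩ := h
    refine ⟨Real.exp l, Real.exp_pos l, ((Real.continuous_exp.tendsto l).comp hl).congr' ?_⟩
    filter_upwards [hpos] with s hs
    have := hU s hs
    exact Real.exp_log (by positivity)
  refine exists_tendsto_atTop_of_dyadic_control
    (fun s => Real.log (U s / s ^ γ)) (fun s => U (s * 2) / U s / a - 1) ((b + 1) / 2)
    (by linarith) (by linarith) ?_ ?_ ?_ ?_
  · intro x hx
    have hx' : 0 < x ^ γ := by positivity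
    have h := ((hU1 x hx).div_const (x ^ γ)).log (by rw [div_self hx'.ne']; exact one_ne_zero)
    rw [div_self hx'.ne', Real.log_one] at h
    refine h.congr' ?_
    filter_upwards [hpos] with s hs
    exact (hglog x s hx hs).symm
  · filter_upwards [hpos, h2.eventually_const_lt hc] with s hs hs2
    have hd : 0 < U (s * 2) / U s - a := (div_pos_iff_of_pos_right (hApos s hs)).1 hs2
    have h1 : 1 ≤ U (s * 2) / U s / a := by rw [le_div_iff₀ ha0]; linarith
    rw [hglog 2 s (by norm_num) hs, ← ha, abs_of_nonneg (Real.log_nonneg h1)]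
    exact Real.log_le_sub_one_of_pos (by linarith)
  · filter_upwards [hpos, h2.eventually_const_lt hc,
      hratio.eventually_lt_const (by linarith : b < (b + 1) / 2)] with s hs hs2 hs3
    have hd : 0 < U (s * 2) / U s - a := (div_pos_iff_of_pos_right (hApos s hs)).1 hs2
    rw [div_lt_iff₀ hd] at hs3
    have h := div_le_div_of_nonneg_right hs3.le ha0.le
    rw [sub_div, div_self ha0.ne', mul_div_assoc, sub_div, div_self ha0.ne'] at h
    exact h
  · have h := (hQ.div_const a).sub_const 1
    rwa [div_self ha0.ne', sub_self] at h

/-- Example 1, extreme level: in the location-scale-shift model with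
bounded shift terms, for an extreme tail quantile level `p_{N,T}` with `NT·p_{N,T}/k → 0`,
`log(k/(NT·p_{N,T}))/√k → 0` and `√k·A₁(NT/k) → 0`, the extreme tail quantile is
asymptotically equivalent to the Weissman extrapolation:
`lim_{N,T→∞} max_{i≤N,t≤T}
  |(α_{i,t} + w_{i,t}·U(NT/k)·(k/(NT·p_{N,T}))^γ)/U(1/p_{N,T}) − w_{i,t}| = 0`. -/
theorem lss_extreme_weissman_equivalence
    (γ ρ : ℝ) (hγ : 0 < γ) (hρ : ρ < 0)
    -- the reference tail quantile function `U : (0,∞) → (0,∞)` and second-order condition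
    (U A₁ : ℝ → ℝ)
    (hUpos : ∀ s : ℝ, 0 < s → 0 < U s)
    (hA₁pos : ∀ s : ℝ, 0 < s → 0 < A₁ s)
    (hA₁dec : ∃ s₀ : ℝ, AntitoneOn A₁ (Set.Ici s₀))
    (hA₁lim : Tendsto A₁ atTop (𝓝 (0 : ℝ)))
    (hU2 : ∀ x : ℝ, 0 < x →
      Tendsto (fun s : ℝ => (U (s * x) / U s - x ^ γ) / A₁ s) atTop
        (𝓝 (x ^ γ * (x ^ ρ - 1) / ρ)))
    -- bounded location shifts `α_{i,t} = α_{0i}ᵀβ_{0t}` and scales `w_{i,t} = l_{0i}ᵀf_{0t}`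
    (m M : ℝ) (hm : 0 < m) (hmM : m ≤ M)
    (α w : ℕ → ℕ → ℕ → ℕ → ℝ)
    (Cα : ℝ) (hα : ∀ N T : ℕ, ∀ i < N, ∀ t < T, |α N T i t| ≤ Cα)
    (hw : ∀ N T : ℕ, ∀ i < N, ∀ t < T, m ≤ w N T i t ∧ w N T i t ≤ M)
    -- the intermediate sequence `k = k(NT)`
    (k : ℕ → ℕ)
    (hk0 : Tendsto (fun NT : ℕ × ℕ => (k (NT.1 * NT.2) : ℝ)) atTop atTop)
    (hk1 : Tendsto (fun NT : ℕ × ℕ => (k (NT.1 * NT.2) : ℝ) / (NT.1 * NT.2)) atTop (𝓝 0))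
    (hk4 : Tendsto (fun NT : ℕ × ℕ => Real.sqrt (k (NT.1 * NT.2)) *
        A₁ ((NT.1 * NT.2 : ℝ) / (k (NT.1 * NT.2)))) atTop (𝓝 0))
    -- the extreme tail quantile level
    (p : ℕ × ℕ → ℝ)
    (hp : ∀ NT : ℕ × ℕ, 0 < p NT ∧ p NT < 1)
    (hp1 : Tendsto (fun NT : ℕ × ℕ => (NT.1 * NT.2 : ℝ) * p NT / (k (NT.1 * NT.2)))
      atTop (𝓝 0))
    (hp2 : Tendsto (fun NT : ℕ × ℕ =>
      Real.log ((k (NT.1 * NT.2) : ℝ) / ((NT.1 * NT.2 : ℝ) * p NT))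
        / Real.sqrt (k (NT.1 * NT.2))) atTop (𝓝 0))
    : ∀ ε : ℝ, 0 < ε → ∀ᶠ NT : ℕ × ℕ in atTop, ∀ i < NT.1, ∀ t < NT.2,
      |(α NT.1 NT.2 i t + w NT.1 NT.2 i t * U ((NT.1 * NT.2 : ℝ) / (k (NT.1 * NT.2))) *
            ((k (NT.1 * NT.2) : ℝ) / ((NT.1 * NT.2 : ℝ) * p NT)) ^ γ)
          / U ((p NT)⁻¹) - w NT.1 NT.2 i t| < ε := by
  obtain ⟨l, hl0, hl⟩ := exists_tendsto_div_rpow_of_second_order hρ hUpos hA₁pos hA₁lim hU2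
  intro ε hε
  have hn0 : ∀ᶠ NT : ℕ × ℕ in atTop, 0 < (NT.1 * NT.2 : ℝ) := by
    filter_upwards [eventually_ge_atTop ((1, 1) : ℕ × ℕ)] with NT h
    have h1 : 0 < NT.1 := h.1
    have h2 : 0 < NT.2 := h.2
    positivity
  have hkpos : ∀ᶠ NT : ℕ × ℕ in atTop, 0 < (k (NT.1 * NT.2) : ℝ) :=
    hk0.eventually_gt_atTop 0
  have ha : Tendsto (fun NT : ℕ × ℕ => (NT.1 * NT.2 : ℝ) / (k (NT.1 * NT.2))) atTop atTop := by
    have h : Tendsto (fun NT : ℕ × ℕ => (k (NT.1 * NT.2) : ℝ) / (NT.1 * NT.2)) atTop (𝓝[>] 0) := by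
      refine tendsto_nhdsWithin_iff.2 ⟨hk1, ?_⟩
      filter_upwards [hn0, hkpos] with NT h1 h2
      exact div_pos h2 h1
    exact h.inv_tendsto_nhdsGT_zero.congr fun NT => by simp
  have hb : Tendsto (fun NT => (p NT)⁻¹) atTop atTop := by
    have h : Tendsto p atTop (𝓝[>] 0) := by
      refine tendsto_nhdsWithin_iff.2 ⟨?_, Eventually.of_forall fun NT => (hp NT).1⟩
      have h := hp1.mul hk1
      rw [mul_zero] at h
      refine h.congr' ?_
      filter_upwards [hn0, hkpos] with NT h1 h2
      rw [div_mul_div_cancel₀ h2.ne', mul_div_cancel_left₀ _ h1.ne']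
    exact h.inv_tendsto_nhdsGT_zero
  have hR : Tendsto (fun NT : ℕ × ℕ => U ((NT.1 * NT.2 : ℝ) / (k (NT.1 * NT.2))) *
      ((k (NT.1 * NT.2) : ℝ) / ((NT.1 * NT.2 : ℝ) * p NT)) ^ γ / U ((p NT)⁻¹)) atTop (𝓝 1) := by
    have h := (hl.comp ha).div (hl.comp hb) hl0.ne'
    rw [div_self hl0.ne'] at h
    refine h.congr' ?_
    filter_upwards [hn0, hkpos] with NT h1 h2
    have hpp := (hp NT).1
    have ha0 : 0 < (NT.1 * NT.2 : ℝ) / (k (NT.1 * NT.2)) := div_pos h1 h2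
    have hU0 := hUpos _ (inv_pos.2 hpp)
    have e : (k (NT.1 * NT.2) : ℝ) / ((NT.1 * NT.2 : ℝ) * p NT)
        = (p NT)⁻¹ / ((NT.1 * NT.2 : ℝ) / (k (NT.1 * NT.2))) := by
      rw [div_div_eq_mul_div, mul_comm (NT.1 * NT.2 : ℝ), ← div_div, div_eq_mul_inv _ (p NT),
        mul_comm (p NT)⁻¹]
    rw [e, Real.div_rpow (inv_pos.2 hpp).le ha0.le]
    have h3 := Real.rpow_pos_of_pos ha0 γ
    have h4 := Real.rpow_pos_of_pos (inv_pos.2 hpp) γ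
    simp only [Function.comp, Pi.div_apply]
    rw [div_div_div_eq, ← mul_div_assoc, div_div]
  have hUtop : Tendsto U atTop atTop := by
    refine (hl.pos_mul_atTop hl0 (tendsto_rpow_atTop hγ)).congr' ?_
    filter_upwards [eventually_gt_atTop 0] with s hs
    exact div_mul_cancel₀ _ (Real.rpow_pos_of_pos hs γ).ne'
  have hbound := ((hUtop.comp hb).const_div_atTop Cα).add ((hR.sub_const 1).abs.const_mul M)
  rw [sub_self, abs_zero, mul_zero, add_zero] at hbound
  filter_upwards [hbound.eventually_lt_const hε] with NT hNT i hi t ht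
  refine lt_of_le_of_lt ?_ hNT
  have hU0 := hUpos _ (inv_pos.2 (hp NT).1)
  have hw' := hw NT.1 NT.2 i hi t ht
  simp only [Function.comp]
  rw [add_div, add_sub_assoc, mul_assoc, mul_div_assoc, ← mul_sub_one]
  refine (abs_add_le _ _).trans (add_le_add ?_ ?_)
  · rw [abs_div, abs_of_pos hU0]
    exact div_le_div_of_nonneg_right (hα NT.1 NT.2 i hi t ht) hU0.le
  · rw [abs_mul, abs_of_pos (hm.trans_le hw'.1)]
    exact mul_le_mul_of_nonneg_right hw'.2 (abs_nonneg _)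
end
end

section
/- Let 𝔽 be a continuous distribution function on ℝ whose tail quantile function U(x) = inf{s : 1 − 𝔽(s) ≤ 1/x} satisfies the second-order condition with index γ > 0. Let W be a random variable with m ≤ W ≤ M almost surely for constants 0 < m ≤ M < ∞, and let V be uniformly distributed on (0,1) and independent of W. Then lim_{s→∞} s · P( W · U(1/V) > U(s) ) = E[ W^{1/γ} ]; in particular, if additionally E[W^{1/γ}] = 1, then W·U(1/V) asymptotically exceeds the level U(s) with probability (1 + o(1))/s. -/
open MeasureTheory ProbabilityTheory Filter Topology

noncomputable section

/-- The tail quantile function of a distribution function is monotone on `(1, ∞)`. -/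
theorem monotoneOn_tailQuantile {F U : ℝ → ℝ}
    (hFbot : Tendsto F atBot (𝓝 (0 : ℝ))) (hFtop : Tendsto F atTop (𝓝 (1 : ℝ)))
    (hUdef : ∀ x : ℝ, 0 < x → U x = sInf {s : ℝ | 1 - F s ≤ x⁻¹}) :
    MonotoneOn U (Set.Ioi 1) := by
  intro x hx y hy hxy
  have hx1 : (1 : ℝ) < x := hx
  have hx0 : 0 < x := by linarith
  have hy0 : 0 < y := by linarith
  rw [hUdef x hx0, hUdef y hy0]
  apply csInf_le_csInf
  · have hx' : (0 : ℝ) < 1 - x⁻¹ := by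
      have := inv_lt_one_of_one_lt₀ hx1
      linarith
    obtain ⟨b, hb⟩ := eventually_atBot.1 (hFbot.eventually_lt_const hx')
    refine ⟨b, fun s hs => ?_⟩
    by_contra! h
    have h1 := hb s h.le
    have h2 : 1 - F s ≤ x⁻¹ := hs
    linarith
  · have hy' : 1 - y⁻¹ < (1 : ℝ) := by
      have := inv_pos.2 hy0
      linarith
    obtain ⟨b, hb⟩ := eventually_atTop.1 (hFtop.eventually_const_lt hy')
    refine ⟨b, ?_⟩
    have := hb b le_rfl
    show 1 - F b ≤ y⁻¹
    linarith
  · intro s hs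
    exact le_trans hs (inv_anti₀ hx0 hxy)

/-- A second-order condition with vanishing auxiliary function implies regular variation. -/
theorem tendsto_ratio_of_second_order {U A : ℝ → ℝ} {x a c : ℝ}
    (hApos : ∀ s : ℝ, 0 < s → 0 < A s) (hAlim : Tendsto A atTop (𝓝 (0 : ℝ)))
    (h : Tendsto (fun s : ℝ => (U (s * x) / U s - a) / A s) atTop (𝓝 c)) :
    Tendsto (fun s : ℝ => U (s * x) / U s) atTop (𝓝 a) := by
  have h1 := (h.mul hAlim).add_const a
  simp only [mul_zero, zero_add] at h1
  refine h1.congr' ?_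
  filter_upwards [eventually_gt_atTop 0] with s hs
  have := (hApos s hs).ne'
  field_simp
  ring

/-- A monotone function that is regularly varying with positive index is eventually positive. -/
theorem eventually_pos_of_tendsto_ratio {U : ℝ → ℝ} {a : ℝ} (ha : 1 < a)
    (hmono : MonotoneOn U (Set.Ioi 1))
    (h : Tendsto (fun s : ℝ => U (s * 2) / U s) atTop (𝓝 a)) :
    ∀ᶠ s in atTop, 0 < U s := by
  obtain ⟨s, hs, hs1⟩ := ((h.eventually_const_lt ha).and (eventually_gt_atTop 1)).exists
  have h2s : (1 : ℝ) < s * 2 := by linarith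
  have hle : U s ≤ U (s * 2) := hmono hs1 h2s (by linarith)
  have hpos : 0 < U (s * 2) := by
    by_contra! hn
    have h0 : U s ≤ 0 := hle.trans hn
    rcases h0.lt_or_eq with h0 | h0
    · rw [lt_div_iff_of_neg h0] at hs
      linarith
    · rw [h0, div_zero] at hs
      linarith
  filter_upwards [eventually_ge_atTop (s * 2)] with y hy
  exact hpos.trans_le (hmono h2s (h2s.trans_le hy) hy)

/-- For a fixed positive scale `w`, the rescaled probability that `w * U (1 / V)` exceeds `U s`,
with `V` uniform on `(0, 1)`, converges to `w ^ (1 / γ)`. -/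
theorem tendsto_scaled_exceedance_const {U : ℝ → ℝ} {γ w : ℝ} (hγ : 0 < γ) (hw : 0 < w)
    (hmono : MonotoneOn U (Set.Ioi 1)) (hpos : ∀ᶠ s in atTop, 0 < U s)
    (hreg : ∀ x : ℝ, 0 < x → Tendsto (fun s : ℝ => U (s * x) / U s) atTop (𝓝 (x ^ γ))) :
    Tendsto (fun s : ℝ =>
        s * (volume.restrict (Set.Ioo (0 : ℝ) 1) {v | U s < w * U v⁻¹}).toReal) atTop
      (𝓝 (w ^ (1 / γ))) := by
  have hwγ : 0 < w ^ (1 / γ) := Real.rpow_pos_of_pos hw _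
  have hinv : ∀ t : ℝ, 0 < t → (t⁻¹) ^ γ = (t ^ γ)⁻¹ := fun t ht => Real.inv_rpow ht.le γ
  have hww : (w ^ (1 / γ)) ^ γ = w := by
    rw [← Real.rpow_mul hw.le, one_div_mul_cancel hγ.ne', Real.rpow_one]
  rw [tendsto_order]
  constructor
  · intro a ha
    obtain ⟨t, hat, htw⟩ := exists_between (max_lt ha hwγ)
    have ht : 0 < t := (le_max_right _ _).trans_lt hat
    have hta : a < t := (le_max_left _ _).trans_lt hat
    have htγ : 0 < t ^ γ := Real.rpow_pos_of_pos ht _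
    have hlt : w⁻¹ < (t⁻¹) ^ γ := by
      rw [hinv t ht]
      apply inv_strictAnti₀ htγ
      calc t ^ γ < (w ^ (1 / γ)) ^ γ := Real.rpow_lt_rpow ht.le htw hγ
        _ = w := hww
    filter_upwards [(hreg t⁻¹ (inv_pos.2 ht)).eventually_const_lt hlt, hpos,
      eventually_gt_atTop t, eventually_gt_atTop 0] with s hs hUs hst hs0
    have hst1 : t / s < 1 := (div_lt_one hs0).2 hst
    have hst' : 1 < s * t⁻¹ := by rw [← div_eq_mul_inv]; exact (one_lt_div ht).2 hst
    rw [lt_div_iff₀ hUs, inv_mul_lt_iff₀ hw] at hs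
    have hsub : Set.Ioo 0 (t / s) ⊆ {v | U s < w * U v⁻¹} ∩ Set.Ioo (0 : ℝ) 1 := by
      intro v hv
      refine ⟨hs.trans_le (mul_le_mul_of_nonneg_left ?_ hw.le), hv.1, hv.2.trans hst1⟩
      have hle : s * t⁻¹ ≤ v⁻¹ := by
        rw [← div_eq_mul_inv, ← inv_div]
        exact inv_anti₀ hv.1 hv.2.le
      exact hmono hst' (hst'.trans_le hle) hle
    have hmeas : ENNReal.ofReal (t / s) ≤
        volume.restrict (Set.Ioo (0 : ℝ) 1) {v | U s < w * U v⁻¹} := by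
      rw [Measure.restrict_apply' measurableSet_Ioo]
      simpa using measure_mono (μ := volume) hsub
    have h1 := (ENNReal.ofReal_le_iff_le_toReal (measure_ne_top _ _)).1 hmeas
    calc a < t := hta
      _ = s * (t / s) := by field_simp
      _ ≤ _ := mul_le_mul_of_nonneg_left h1 hs0.le
  · intro a ha
    obtain ⟨t, htw, hta⟩ := exists_between ha
    have ht : 0 < t := hwγ.trans htw
    have hlt : (t⁻¹) ^ γ < w⁻¹ := by
      rw [hinv t ht]
      apply inv_strictAnti₀ hw
      calc w = (w ^ (1 / γ)) ^ γ := hww.symm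
        _ < t ^ γ := Real.rpow_lt_rpow hwγ.le htw hγ
    filter_upwards [(hreg t⁻¹ (inv_pos.2 ht)).eventually_lt_const hlt, hpos,
      eventually_gt_atTop t, eventually_gt_atTop 0] with s hs hUs hst hs0
    have hst' : 1 < s * t⁻¹ := by rw [← div_eq_mul_inv]; exact (one_lt_div ht).2 hst
    rw [div_lt_iff₀ hUs, lt_inv_mul_iff₀ hw] at hs
    have hsub : {v | U s < w * U v⁻¹} ∩ Set.Ioo (0 : ℝ) 1 ⊆ Set.Ioo 0 (t / s) := by
      rintro v ⟨hv, hv0, hv1⟩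
      refine ⟨hv0, ?_⟩
      by_contra! hle
      have hle' : v⁻¹ ≤ s * t⁻¹ := by
        rw [← div_eq_mul_inv, ← inv_div]
        exact inv_anti₀ (by positivity) hle
      have hU : U v⁻¹ ≤ U (s * t⁻¹) := hmono ((one_lt_inv₀ hv0).2 hv1) hst' hle'
      have hv' : U s < w * U v⁻¹ := hv
      linarith [mul_le_mul_of_nonneg_left hU hw.le]
    have hmeas : volume.restrict (Set.Ioo (0 : ℝ) 1) {v | U s < w * U v⁻¹} ≤
        ENNReal.ofReal (t / s) := by
      rw [Measure.restrict_apply' measurableSet_Ioo]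
      simpa using measure_mono (μ := volume) hsub
    have h1 := ENNReal.toReal_le_of_le_ofReal (by positivity) hmeas
    calc s * _ ≤ s * (t / s) := mul_le_mul_of_nonneg_left h1 hs0.le
      _ = t := by field_simp
      _ < a := hta

/-- let `𝔽` be a continuous distribution function on `ℝ` whose tail
quantile function `U(x) = inf{s : 1 − 𝔽(s) ≤ 1/x}` satisfies the second-order condition with
index `γ > 0`. Let `W` be a random variable with `m ≤ W ≤ M` a.s. (`0 < m ≤ M < ∞`), and let
`V` be uniform on `(0,1)`, independent of `W`. Then
`lim_{s→∞} s·P(W·U(1/V) > U(s)) = E[W^{1/γ}]`; in particular, if `E[W^{1/γ}] = 1`, then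
`W·U(1/V)` exceeds the level `U(s)` with probability `(1 + o(1))/s`. -/
theorem scaled_tail_exceedance_probability_limit
    {Ω : Type} [MeasureSpace Ω] [IsProbabilityMeasure (ℙ : Measure Ω)]
    (γ ρ : ℝ) (hγ : 0 < γ) (hρ : ρ < 0)
    -- the continuous distribution function `𝔽` and its tail quantile function `U`
    (F : ℝ → ℝ)
    (hFcont : Continuous F) (hFmono : Monotone F)
    (hFbot : Tendsto F atBot (𝓝 (0 : ℝ))) (hFtop : Tendsto F atTop (𝓝 (1 : ℝ)))
    (U : ℝ → ℝ)
    (hUdef : ∀ x : ℝ, 0 < x → U x = sInf {s : ℝ | 1 - F s ≤ x⁻¹})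
    -- the second-order condition
    (A₁ : ℝ → ℝ)
    (hA₁pos : ∀ s : ℝ, 0 < s → 0 < A₁ s)
    (hA₁dec : ∃ s₀ : ℝ, AntitoneOn A₁ (Set.Ici s₀))
    (hA₁lim : Tendsto A₁ atTop (𝓝 (0 : ℝ)))
    (hU2 : ∀ x : ℝ, 0 < x →
      Tendsto (fun s : ℝ => (U (s * x) / U s - x ^ γ) / A₁ s) atTop
        (𝓝 (x ^ γ * (x ^ ρ - 1) / ρ)))
    -- the bounded random scale `W` and the independent uniform variable `V`
    (m M : ℝ) (hm : 0 < m) (hmM : m ≤ M)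
    (W V : Ω → ℝ) (hWmeas : Measurable W) (hVmeas : Measurable V)
    (hWbdd : ∀ᵐ ω ∂ℙ, m ≤ W ω ∧ W ω ≤ M)
    (hVunif : Measure.map V ℙ = volume.restrict (Set.Ioo (0 : ℝ) 1))
    (hWVindep : IndepFun W V ℙ)
    : Tendsto (fun s : ℝ => s * (ℙ {ω | U s < W ω * U (V ω)⁻¹}).toReal) atTop
        (𝓝 (∫ ω, W ω ^ (1 / γ) ∂ℙ)) ∧
      ((∫ ω, W ω ^ (1 / γ) ∂ℙ) = 1 →
        Tendsto (fun s : ℝ => s * (ℙ {ω | U s < W ω * U (V ω)⁻¹}).toReal) atTop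
          (𝓝 1)) := by
  have hmono := monotoneOn_tailQuantile hFbot hFtop hUdef
  have hreg : ∀ x : ℝ, 0 < x → Tendsto (fun s : ℝ => U (s * x) / U s) atTop (𝓝 (x ^ γ)) :=
    fun x hx => tendsto_ratio_of_second_order hA₁pos hA₁lim (hU2 x hx)
  have hpos : ∀ᶠ s in atTop, 0 < U s :=
    eventually_pos_of_tendsto_ratio (Real.one_lt_rpow one_lt_two hγ) hmono
      (hreg 2 two_pos)
  set ν : Measure ℝ := volume.restrict (Set.Ioo (0 : ℝ) 1) with hν
  have hanti : AntitoneOn (fun v : ℝ => U v⁻¹) (Set.Ioo 0 1) := fun v hv v' hv' h =>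
    hmono ((one_lt_inv₀ hv'.1).2 hv'.2) ((one_lt_inv₀ hv.1).2 hv.2) (inv_anti₀ hv.1 h)
  have hUae : AEMeasurable (fun v : ℝ => U v⁻¹) ν :=
    aemeasurable_restrict_of_antitoneOn measurableSet_Ioo hanti
  set G : ℝ → ℝ := hUae.mk _
  have hGmeas : Measurable G := hUae.measurable_mk
  have hGae : (fun v : ℝ => U v⁻¹) =ᵐ[ν] G := hUae.ae_eq_mk
  have hslice : ∀ s w : ℝ, ν {v | U s < w * G v} = ν {v | U s < w * U v⁻¹} := by
    intro s w
    apply measure_congr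
    filter_upwards [hGae] with v hv
    apply propext
    change U s < w * G v ↔ U s < w * U v⁻¹
    rw [← hv]
  have hSmeas : ∀ s : ℝ, MeasurableSet {p : ℝ × ℝ | U s < p.1 * G p.2} := fun s =>
    measurableSet_lt measurable_const (measurable_fst.mul (hGmeas.comp measurable_snd))
  have hφmeas : ∀ s : ℝ, Measurable fun w : ℝ => ν {v | U s < w * G v} := fun s =>
    measurable_measure_prodMk_left (hSmeas s)
  have hprob : ∀ s : ℝ, s * (ℙ {ω | U s < W ω * U (V ω)⁻¹}).toReal =
      ∫ ω, s * (ν {v | U s < W ω * G v}).toReal ∂ℙ := by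
    intro s
    have hVae : ∀ᵐ ω ∂(ℙ : Measure Ω), U (V ω)⁻¹ = G (V ω) :=
      ae_of_ae_map hVmeas.aemeasurable (by rw [hVunif]; exact hGae)
    have h1 : (ℙ : Measure Ω) {ω | U s < W ω * U (V ω)⁻¹} =
        ℙ ((fun ω => (W ω, V ω)) ⁻¹' {p : ℝ × ℝ | U s < p.1 * G p.2}) := by
      apply measure_congr
      filter_upwards [hVae] with ω hω
      apply propext
      change U s < W ω * U (V ω)⁻¹ ↔ U s < W ω * G (V ω)
      rw [hω]
    rw [h1, ← Measure.map_apply (hWmeas.prodMk hVmeas) (hSmeas s),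
      (indepFun_iff_map_prod_eq_prod_map_map hWmeas.aemeasurable hVmeas.aemeasurable).1 hWVindep,
      hVunif, Measure.prod_apply (hSmeas s),
      lintegral_map (measurable_measure_prodMk_left (hSmeas s)) hWmeas,
      integral_const_mul, integral_toReal]
    · rfl
    · exact ((hφmeas s).comp hWmeas).aemeasurable
    · exact Eventually.of_forall fun ω => measure_lt_top _ _
  have hlim : Tendsto (fun s : ℝ => s * (ℙ {ω | U s < W ω * U (V ω)⁻¹}).toReal) atTop
      (𝓝 (∫ ω, W ω ^ (1 / γ) ∂ℙ)) := by
    simp only [hprob]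
    have hM : 0 < M := hm.trans_le hmM
    have hbound : ∀ᶠ s in atTop,
        s * (ν {v | U s < M * U v⁻¹}).toReal < M ^ (1 / γ) + 1 :=
      (tendsto_scaled_exceedance_const hγ hM hmono hpos hreg).eventually_lt_const
        (lt_add_one _)
    refine tendsto_integral_filter_of_dominated_convergence (fun _ => M ^ (1 / γ) + 1)
      ?_ ?_ (integrable_const _) ?_
    · exact Eventually.of_forall fun s =>
        (((hφmeas s).comp hWmeas).ennreal_toReal.const_mul s).aestronglyMeasurable
    · filter_upwards [hbound, hpos, eventually_gt_atTop 0] with s hs hUs hs0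
      filter_upwards [hWbdd] with ω hω
      rw [Real.norm_of_nonneg (by positivity), hslice]
      refine le_trans (mul_le_mul_of_nonneg_left ?_ hs0.le) hs.le
      refine ENNReal.toReal_mono (measure_ne_top _ _) (measure_mono fun v hv => ?_)
      have hv' : U s < W ω * U v⁻¹ := hv
      have hU : 0 < U v⁻¹ := pos_of_mul_pos_right (hUs.trans hv') (hm.trans_le hω.1).le
      exact hv'.trans_le (mul_le_mul_of_nonneg_right hω.2 hU.le)
    · filter_upwards [hWbdd] with ω hω
      simp only [hslice]
      exact tendsto_scaled_exceedance_const hγ (hm.trans_le hω.1) hmono hpos hreg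
  exact ⟨hlim, fun h => h ▸ hlim⟩
end
end
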